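/- Let $P$ be a centered probability measure on $\mathbb{R}$ with bounded support, and define the replica-symmetric potential $F(\lambda, q) = \psi(\lambda q) - \lambda q^2/4$ where $\psi(r) = \mathbb{E}_{x^*,z}\log \int \exp(\sqrt{r} z x + r x x^* - \tfrac{r}{2}x^2)\,dP(x)$. If $\lambda > (\mathbb{E}_P[X^2])^{-2}$, then $q = 0$ is not a local maximizer of $q \mapsto F(\lambda, q)$ on $[0,\infty)$; in particular $\partial_q F(\lambda,0) = 0$ and $\partial_q^2 F(\lambda, 0) = \tfrac{\lambda}{2}(\lambda (\mathbb{E}_P[X^2])^2 - 1) > 0$. -/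

import Mathlib

open MeasureTheory ProbabilityTheory

theorem abs_exp_sub_one_sub_id_le_mul_exp (u : ℝ) :
    |Real.exp u - 1 - u| ≤ |u| ^ 2 * Real.exp |u| := by
  have h := Complex.norm_exp_sub_sum_le_norm_mul_exp (u : ℂ) 2
  simp only [Finset.sum_range_succ, Finset.sum_range_zero] at h
  norm_num at h
  rw [← sub_sub] at h
  rw [sq_abs]
  exact_mod_cast h

theorem abs_exp_sub_quadratic_le_mul_exp (u : ℝ) :
    |Real.exp u - 1 - u - u ^ 2 / 2| ≤ |u| ^ 3 * Real.exp |u| := by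
  have h := Complex.norm_exp_sub_sum_le_norm_mul_exp (u : ℂ) 3
  simp only [Finset.sum_range_succ, Finset.sum_range_zero] at h
  norm_num [Nat.factorial] at h
  rw [← sub_sub, ← sub_sub] at h
  exact_mod_cast h

theorem abs_log_sub_le {t : ℝ} (ht : 0 < t) :
    |Real.log t - (t - 1)| ≤ (t - 1) ^ 2 / t := by
  have h1 := Real.log_le_sub_one_of_pos ht
  have h2 := Real.one_sub_inv_le_log_of_pos ht
  rw [abs_le]
  constructor
  · have : (t - 1) ^ 2 / t = (t - 1) - (1 - t⁻¹) := by field_simp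
    linarith
  · have : 0 ≤ (t - 1) ^ 2 / t := by positivity
    linarith

theorem integral_sq_sub_one_sq_gaussianReal :
    ∫ z, (z ^ 2 - 1) ^ 2 ∂(gaussianReal 0 1) = 2 := by
  have hE : ∀ t : ℝ, HasDerivAt (fun t : ℝ => Real.exp (t ^ 2 / 2))
      (Real.exp (t ^ 2 / 2) * t) t := by
    intro t
    have := ((hasDerivAt_pow 2 t).div_const 2).exp
    convert this using 1
    simp
  have h1 : deriv (fun t : ℝ => Real.exp (t ^ 2 / 2)) = fun t => Real.exp (t ^ 2 / 2) * t :=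
    funext fun t => (hE t).deriv
  have h2 : deriv (fun t : ℝ => Real.exp (t ^ 2 / 2) * t) =
      fun t => Real.exp (t ^ 2 / 2) * (t ^ 2 + 1) :=
    funext fun t => (((hE t).mul (hasDerivAt_id t)).congr_deriv (by simp; ring)).deriv
  have h3 : deriv (fun t : ℝ => Real.exp (t ^ 2 / 2) * (t ^ 2 + 1)) =
      fun t => Real.exp (t ^ 2 / 2) * (t ^ 3 + 3 * t) :=
    funext fun t => (((hE t).mul ((hasDerivAt_pow 2 t).add_const 1)).congr_deriv
      (by simp; ring)).deriv
  have h4 : deriv (fun t : ℝ => Real.exp (t ^ 2 / 2) * (t ^ 3 + 3 * t)) 0 = 3 :=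
    (((hE 0).mul ((hasDerivAt_pow 3 (0 : ℝ)).add
      ((hasDerivAt_id (0 : ℝ)).const_mul 3))).congr_deriv (by simp)).deriv
  have hmgf : mgf id (gaussianReal 0 1) = fun t : ℝ => Real.exp (t ^ 2 / 2) := by
    rw [mgf_id_gaussianReal]; simp
  have h_int : (0 : ℝ) ∈ interior (integrableExpSet id (gaussianReal 0 1)) := by
    simp [integrableExpSet_id_gaussianReal]
  have m2 : ∫ z, z ^ 2 ∂(gaussianReal 0 1) = 1 := by
    have := iteratedDeriv_mgf_zero h_int 2
    rw [hmgf] at this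
    simp only [iteratedDeriv_succ, iteratedDeriv_zero, h1, h2] at this
    simpa using this.symm
  have m4 : ∫ z, z ^ 4 ∂(gaussianReal 0 1) = 3 := by
    have := iteratedDeriv_mgf_zero h_int 4
    rw [hmgf] at this
    simp only [iteratedDeriv_succ, iteratedDeriv_zero, h1, h2, h3, h4] at this
    simpa using this.symm
  have i2 : Integrable (fun z : ℝ => z ^ 2) (gaussianReal 0 1) := by
    simpa using (memLp_id_gaussianReal (μ := 0) (v := 1) 2).integrable_norm_pow (by simp)
  have i4 : Integrable (fun z : ℝ => z ^ 4) (gaussianReal 0 1) := by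
    have := (memLp_id_gaussianReal (μ := 0) (v := 1) 4).integrable_norm_pow (p := 4) (by simp)
    simpa [Even.pow_abs (show Even 4 by decide)] using this
  calc _ = ∫ z, (z ^ 4 - 2 * z ^ 2 + 1) ∂(gaussianReal 0 1) := by congr 1; ext z; ring
    _ = 2 := by
      rw [integral_add (f := fun z : ℝ => z ^ 4 - 2 * z ^ 2) (i4.sub (i2.const_mul 2))
        (integrable_const _), integral_sub i4 (i2.const_mul 2), integral_const_mul, m2, m4]
      norm_num

theorem integral_gaussianReal_add_const (f : ℝ → ℝ) (c : ℝ) :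
    ∫ z, f (z + c) ∂(gaussianReal 0 1) =
      ∫ z, f z * Real.exp (c * z - c ^ 2 / 2) ∂(gaussianReal 0 1) := by
  simp only [integral_gaussianReal_eq_integral_smul (one_ne_zero), smul_eq_mul]
  rw [← integral_add_right_eq_self (fun z => gaussianPDFReal 0 1 z *
    (f z * Real.exp (c * z - c ^ 2 / 2))) c]
  congr 1; ext z
  simp only [gaussianPDFReal]
  have : Real.exp (-(z - 0) ^ 2 / (2 * (1 : NNReal))) =
    Real.exp (-(z + c - 0) ^ 2 / (2 * (1 : NNReal))) * Real.exp (c * (z + c) - c ^ 2 / 2) := by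
    rw [← Real.exp_add]; congr 1; push_cast; ring
  rw [this]; ring

theorem abs_exponent_le {K s x : ℝ} (z : ℝ) (hs0 : 0 ≤ s) (hs1 : s ≤ 1) (hx : |x| ≤ K) :
    |s * z * x - s ^ 2 * x ^ 2 / 2| ≤ s * (|z| * K + K ^ 2) := by
  have h1 : |z * x| ≤ |z| * K := by rw [abs_mul]; gcongr
  have h2 : x ^ 2 ≤ K ^ 2 := by rw [← sq_abs x]; gcongr
  have h3 : |z * x - s * x ^ 2 / 2| ≤ |z| * K + K ^ 2 := by
    rw [abs_le] at h1 ⊢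
    constructor <;> nlinarith [mul_nonneg hs0 (sq_nonneg x), sq_nonneg x]
  calc |s * z * x - s ^ 2 * x ^ 2 / 2| = s * |z * x - s * x ^ 2 / 2| := by
        rw [← abs_of_nonneg hs0, ← abs_mul, abs_of_nonneg hs0]; ring_nf
    _ ≤ _ := by gcongr

theorem abs_exponent_deriv_le {K s x : ℝ} (z : ℝ) (hs0 : 0 ≤ s) (hs1 : s ≤ 1) (hx : |x| ≤ K) :
    |z * x - s * x ^ 2| ≤ |z| * K + K ^ 2 := by
  have h1 : |z * x| ≤ |z| * K := by rw [abs_mul]; gcongr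
  have h2 : x ^ 2 ≤ K ^ 2 := by rw [← sq_abs x]; gcongr
  rw [abs_le] at h1 ⊢
  constructor <;> nlinarith [mul_nonneg hs0 (sq_nonneg x), sq_nonneg x]

/-- The exponential envelope in `z` of all likelihood-ratio quantities for a prior supported in
`[-K, K]`. -/
noncomputable def envelope (K z : ℝ) : ℝ := Real.exp (|z| * K + K ^ 2)

theorem abs_likelihood_sub_quadratic_le {K s x : ℝ} (z : ℝ) (hs0 : 0 ≤ s) (hs1 : s ≤ 1)
    (hx : |x| ≤ K) :
    |Real.exp (s * z * x - s ^ 2 * x ^ 2 / 2) - (1 + s * z * x + s ^ 2 * (z ^ 2 - 1) / 2 * x ^ 2)|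
      ≤ 2 * s ^ 3 * envelope K z ^ 4 := by
  have hK : 0 ≤ K := (abs_nonneg x).trans hx
  have hu := abs_exponent_le z hs0 hs1 hx
  set B := |z| * K + K ^ 2 with hB
  have hB0 : 0 ≤ B := by positivity
  set u := s * z * x - s ^ 2 * x ^ 2 / 2 with hu_def
  have hE : B ≤ envelope K z := by
    have := Real.add_one_le_exp B
    unfold envelope; linarith
  have hE1 : 1 ≤ envelope K z := Real.one_le_exp hB0
  have huB : Real.exp |u| ≤ envelope K z :=
    Real.exp_le_exp.2 (hu.trans (mul_le_of_le_one_left hB0 hs1))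
  have h1 : |Real.exp u - 1 - u - u ^ 2 / 2| ≤ s ^ 3 * envelope K z ^ 4 := by
    refine (abs_exp_sub_quadratic_le_mul_exp u).trans ?_
    calc |u| ^ 3 * Real.exp |u| ≤ (s * envelope K z) ^ 3 * envelope K z := by
          gcongr; exact hu.trans (by gcongr)
      _ = _ := by ring
  have h2 : |-(s ^ 3 * (z * x * x ^ 2 / 2)) + s ^ 4 * (x ^ 2 * x ^ 2) / 8|
      ≤ s ^ 3 * envelope K z ^ 4 := by
    have a1 : |z * x| ≤ |z| * K := by rw [abs_mul]; gcongr
    have a2 : x ^ 2 ≤ K ^ 2 := by rw [← sq_abs x]; gcongr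
    have a3 : |z * x * x ^ 2| ≤ |z| * K * K ^ 2 := by
      rw [abs_mul, abs_of_nonneg (sq_nonneg x)]; gcongr
    have a4 : s * (x ^ 2 * x ^ 2) ≤ 1 * (K ^ 2 * K ^ 2) := by gcongr
    have a5 : |-(z * x * x ^ 2 / 2) + s * (x ^ 2 * x ^ 2) / 8| ≤ B ^ 2 := by
      have : 0 ≤ s * (x ^ 2 * x ^ 2) := by positivity
      have : 0 ≤ |z| * K * K ^ 2 := by positivity
      rw [abs_le] at a3 ⊢
      constructor <;> nlinarith [sq_nonneg (|z| * K), sq_nonneg (K ^ 2)]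
    calc _ = s ^ 3 * |-(z * x * x ^ 2 / 2) + s * (x ^ 2 * x ^ 2) / 8| := by
          rw [← abs_of_nonneg (pow_nonneg hs0 3), ← abs_mul, abs_of_nonneg (pow_nonneg hs0 3)]
          ring_nf
      _ ≤ s ^ 3 * envelope K z ^ 2 := by gcongr; exact a5.trans (by gcongr)
      _ ≤ _ := by gcongr; norm_num
  calc _ = |(Real.exp u - 1 - u - u ^ 2 / 2) +
        (-(s ^ 3 * (z * x * x ^ 2 / 2)) + s ^ 4 * (x ^ 2 * x ^ 2) / 8)| := by
        congr 1; rw [hu_def]; ring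
    _ ≤ _ := abs_add_le _ _
    _ ≤ _ := by linarith

theorem abs_likelihood_deriv_sub_linear_le {K s x : ℝ} (z : ℝ) (hs0 : 0 ≤ s) (hs1 : s ≤ 1)
    (hx : |x| ≤ K) :
    |(z * x - s * x ^ 2) * Real.exp (s * z * x - s ^ 2 * x ^ 2 / 2) -
        (z * x + s * (z ^ 2 - 1) * x ^ 2)| ≤ 3 * s ^ 2 * envelope K z ^ 4 := by
  have hK : 0 ≤ K := (abs_nonneg x).trans hx
  have hu := abs_exponent_le z hs0 hs1 hx
  have hv := abs_exponent_deriv_le z hs0 hs1 hx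
  set B := |z| * K + K ^ 2 with hB
  have hB0 : 0 ≤ B := by positivity
  set u := s * z * x - s ^ 2 * x ^ 2 / 2 with hu_def
  have hE : B ≤ envelope K z := by
    have := Real.add_one_le_exp B
    unfold envelope; linarith
  have hE1 : 1 ≤ envelope K z := Real.one_le_exp hB0
  have huB : Real.exp |u| ≤ envelope K z :=
    Real.exp_le_exp.2 (hu.trans (mul_le_of_le_one_left hB0 hs1))
  have h1 : |(z * x - s * x ^ 2) * (Real.exp u - 1 - u)| ≤ s ^ 2 * envelope K z ^ 4 := by
    rw [abs_mul]
    calc _ ≤ envelope K z * ((s * envelope K z) ^ 2 * envelope K z) := by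
          gcongr
          · exact hv.trans hE
          · refine (abs_exp_sub_one_sub_id_le_mul_exp u).trans ?_
            gcongr; exact hu.trans (by gcongr)
      _ = _ := by ring
  have h2 : |-(s ^ 2 * (3 / 2 * (z * x * x ^ 2))) + s ^ 3 * (x ^ 2 * x ^ 2) / 2|
      ≤ 2 * (s ^ 2 * envelope K z ^ 4) := by
    have a1 : |z * x| ≤ |z| * K := by rw [abs_mul]; gcongr
    have a2 : x ^ 2 ≤ K ^ 2 := by rw [← sq_abs x]; gcongr
    have a3 : |z * x * x ^ 2| ≤ |z| * K * K ^ 2 := by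
      rw [abs_mul, abs_of_nonneg (sq_nonneg x)]; gcongr
    have a4 : s * (x ^ 2 * x ^ 2) ≤ 1 * (K ^ 2 * K ^ 2) := by gcongr
    have a5 : |-(3 / 2 * (z * x * x ^ 2)) + s * (x ^ 2 * x ^ 2) / 2| ≤ 2 * B ^ 2 := by
      have : 0 ≤ s * (x ^ 2 * x ^ 2) := by positivity
      have : 0 ≤ |z| * K * K ^ 2 := by positivity
      rw [abs_le] at a3 ⊢
      constructor <;> nlinarith [sq_nonneg (|z| * K), sq_nonneg (K ^ 2)]
    calc _ = s ^ 2 * |-(3 / 2 * (z * x * x ^ 2)) + s * (x ^ 2 * x ^ 2) / 2| := by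
          rw [← abs_of_nonneg (pow_nonneg hs0 2), ← abs_mul, abs_of_nonneg (pow_nonneg hs0 2)]
          ring_nf
      _ ≤ s ^ 2 * (2 * envelope K z ^ 2) := by gcongr; exact a5.trans (by gcongr)
      _ ≤ s ^ 2 * (2 * envelope K z ^ 4) := by gcongr; norm_num
      _ = _ := by ring
  calc _ = |(z * x - s * x ^ 2) * (Real.exp u - 1 - u) +
        (-(s ^ 2 * (3 / 2 * (z * x * x ^ 2))) + s ^ 3 * (x ^ 2 * x ^ 2) / 2)| := by
        congr 1; rw [hu_def]; ring
    _ ≤ _ := abs_add_le _ _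
    _ ≤ _ := by linarith

theorem one_le_envelope {K : ℝ} (hK : 0 ≤ K) (z : ℝ) : 1 ≤ envelope K z :=
  Real.one_le_exp (by positivity)

theorem integrable_envelope_pow (K : ℝ) (n : ℕ) :
    Integrable (fun z => envelope K z ^ n) (gaussianReal 0 1) := by
  have h := integrable_exp_mul_abs (μ := gaussianReal 0 1) (X := id) (t := n * K)
    (integrable_exp_mul_gaussianReal _) (integrable_exp_mul_gaussianReal _)
  refine (h.mul_const (Real.exp (n * K ^ 2))).congr (Filter.Eventually.of_forall fun z => ?_)
  simp only [envelope, ← Real.exp_nat_mul, ← Real.exp_add, id]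
  congr 1; ring

/-- The likelihood ratio at observation `z` of the channel `z = s x + noise` with prior `P`,
relative to pure noise. -/
noncomputable def likelihoodRatio (P : Measure ℝ) (s z : ℝ) : ℝ :=
  ∫ x, Real.exp (s * z * x - s ^ 2 * x ^ 2 / 2) ∂P

/-- The derivative of `likelihoodRatio P s z` in `s`. -/
noncomputable def likelihoodRatioDeriv (P : Measure ℝ) (s z : ℝ) : ℝ :=
  ∫ x, (z * x - s * x ^ 2) * Real.exp (s * z * x - s ^ 2 * x ^ 2 / 2) ∂P

theorem measurable_likelihoodRatio (P : Measure ℝ) [IsProbabilityMeasure P] (s : ℝ) :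
    Measurable (likelihoodRatio P s) := by
  have : Continuous (fun p : ℝ × ℝ => Real.exp (s * p.1 * p.2 - s ^ 2 * p.2 ^ 2 / 2)) := by
    fun_prop
  exact (this.stronglyMeasurable.integral_prod_right' (ν := P)).measurable

theorem measurable_likelihoodRatioDeriv (P : Measure ℝ) [IsProbabilityMeasure P] (s : ℝ) :
    Measurable (likelihoodRatioDeriv P s) := by
  have : Continuous (fun p : ℝ × ℝ =>
      (p.1 * p.2 - s * p.2 ^ 2) * Real.exp (s * p.1 * p.2 - s ^ 2 * p.2 ^ 2 / 2)) := by
    fun_prop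
  exact (this.stronglyMeasurable.integral_prod_right' (ν := P)).measurable

section BoundedSupport

variable {P : Measure ℝ} {K s : ℝ}

theorem ae_exp_mem_Icc (hK : ∀ᵐ x ∂P, |x| ≤ K) (z : ℝ) (hs0 : 0 ≤ s) (hs1 : s ≤ 1) :
    ∀ᵐ x ∂P, (envelope K z)⁻¹ ≤ Real.exp (s * z * x - s ^ 2 * x ^ 2 / 2) ∧
      Real.exp (s * z * x - s ^ 2 * x ^ 2 / 2) ≤ envelope K z := by
  filter_upwards [hK] with x hx
  have hK0 : 0 ≤ K := (abs_nonneg x).trans hx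
  have h := (abs_exponent_le z hs0 hs1 hx).trans (mul_le_of_le_one_left (by positivity) hs1)
  rw [abs_le] at h
  rw [envelope, ← Real.exp_neg]
  exact ⟨Real.exp_le_exp.2 h.1, Real.exp_le_exp.2 h.2⟩

theorem ae_abs_likelihood_deriv_le (hK : ∀ᵐ x ∂P, |x| ≤ K) (z : ℝ) :
    ∀ᵐ x ∂P, ∀ s ∈ Set.Icc (0 : ℝ) 1,
      ‖(z * x - s * x ^ 2) * Real.exp (s * z * x - s ^ 2 * x ^ 2 / 2)‖ ≤
        (|z| * K + K ^ 2) * envelope K z := by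
  filter_upwards [hK] with x hx s hs
  have hK0 : 0 ≤ K := (abs_nonneg x).trans hx
  have h := (abs_exponent_le z hs.1 hs.2 hx).trans (mul_le_of_le_one_left (by positivity) hs.2)
  rw [Real.norm_eq_abs, abs_mul, Real.abs_exp]
  gcongr
  · exact abs_exponent_deriv_le z hs.1 hs.2 hx
  · exact Real.exp_le_exp.2 ((le_abs_self _).trans h)

variable [IsProbabilityMeasure P]

theorem nonneg_of_ae_abs_le (hK : ∀ᵐ x ∂P, |x| ≤ K) : 0 ≤ K := by
  obtain ⟨x, hx⟩ := hK.exists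
  exact (abs_nonneg x).trans hx

theorem integrable_id_of_ae_abs_le (hK : ∀ᵐ x ∂P, |x| ≤ K) : Integrable (fun x => x) P :=
  Integrable.of_bound (by fun_prop) K hK

theorem integrable_sq_of_ae_abs_le (hK : ∀ᵐ x ∂P, |x| ≤ K) : Integrable (fun x => x ^ 2) P :=
  Integrable.of_bound (by fun_prop) (K ^ 2) (hK.mono fun x hx => by
    rw [Real.norm_eq_abs, abs_pow]; gcongr)

theorem integrable_likelihood (hK : ∀ᵐ x ∂P, |x| ≤ K) (z : ℝ) (hs0 : 0 ≤ s) (hs1 : s ≤ 1) :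
    Integrable (fun x => Real.exp (s * z * x - s ^ 2 * x ^ 2 / 2)) P :=
  Integrable.of_bound (by fun_prop) (envelope K z) ((ae_exp_mem_Icc hK z hs0 hs1).mono
    fun x hx => by rw [Real.norm_eq_abs, Real.abs_exp]; exact hx.2)

theorem integrable_likelihood_deriv (hK : ∀ᵐ x ∂P, |x| ≤ K) (z : ℝ) (hs0 : 0 ≤ s)
    (hs1 : s ≤ 1) :
    Integrable (fun x => (z * x - s * x ^ 2) * Real.exp (s * z * x - s ^ 2 * x ^ 2 / 2)) P :=
  Integrable.of_bound (by fun_prop) _ ((ae_abs_likelihood_deriv_le hK z).mono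
    fun _ hx => hx s ⟨hs0, hs1⟩)

theorem likelihoodRatio_mem_Icc (hK : ∀ᵐ x ∂P, |x| ≤ K) (z : ℝ) (hs0 : 0 ≤ s) (hs1 : s ≤ 1) :
    (envelope K z)⁻¹ ≤ likelihoodRatio P s z ∧ likelihoodRatio P s z ≤ envelope K z := by
  have hi := integrable_likelihood hK z hs0 hs1
  have h := ae_exp_mem_Icc hK z hs0 hs1
  constructor
  · simpa [likelihoodRatio] using
      integral_mono_ae (integrable_const _) hi (h.mono fun _ => And.left)
  · simpa [likelihoodRatio] using
      integral_mono_ae hi (integrable_const _) (h.mono fun _ => And.right)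

theorem likelihoodRatio_pos (hK : ∀ᵐ x ∂P, |x| ≤ K) (z : ℝ) (hs0 : 0 ≤ s) (hs1 : s ≤ 1) :
    0 < likelihoodRatio P s z :=
  (inv_pos.2 (Real.exp_pos _)).trans_le (likelihoodRatio_mem_Icc hK z hs0 hs1).1

theorem hasDerivAt_likelihoodRatio (hK : ∀ᵐ x ∂P, |x| ≤ K) (z : ℝ) (hs : s ∈ Set.Ioo (0 : ℝ) 1) :
    HasDerivAt (fun t => likelihoodRatio P t z) (likelihoodRatioDeriv P s z) s := by
  refine (hasDerivAt_integral_of_dominated_loc_of_deriv_le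
    (F' := fun s x => (z * x - s * x ^ 2) * Real.exp (s * z * x - s ^ 2 * x ^ 2 / 2))
    (Icc_mem_nhds hs.1 hs.2) (Filter.Eventually.of_forall fun t => by fun_prop)
    (integrable_likelihood hK z hs.1.le hs.2.le) (by fun_prop)
    (ae_abs_likelihood_deriv_le hK z) (integrable_const _)
    (Filter.Eventually.of_forall fun x t _ => ?_)).2
  have h1 : HasDerivAt (fun t : ℝ => t * z * x - t ^ 2 * x ^ 2 / 2) (z * x - t * x ^ 2) t := by
    have := (((hasDerivAt_id t).mul_const z).mul_const x).sub
      (((hasDerivAt_pow 2 t).mul_const (x ^ 2)).div_const 2)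
    refine this.congr_deriv ?_
    simp; ring
  exact h1.exp.congr_deriv (mul_comm _ _)

theorem abs_integral_sub_affine_le (hK : ∀ᵐ x ∂P, |x| ≤ K) (hcent : ∫ x, x ∂P = 0)
    {f : ℝ → ℝ} (hf : Integrable f P) {a b c C : ℝ}
    (h : ∀ᵐ x ∂P, |f x - (a + b * x + c * x ^ 2)| ≤ C) :
    |∫ x, f x ∂P - (a + c * ∫ x, x ^ 2 ∂P)| ≤ C := by
  have i1 := (integrable_id_of_ae_abs_le hK).const_mul b
  have i2 := (integrable_sq_of_ae_abs_le hK).const_mul c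
  have i3 : Integrable (fun x => a + b * x) P := (integrable_const a).add i1
  have e : ∫ x, (a + b * x + c * x ^ 2) ∂P = a + c * ∫ x, x ^ 2 ∂P := by
    rw [integral_add i3 i2, integral_add (integrable_const a) i1, integral_const_mul,
      integral_const_mul, hcent]
    simp
  rw [← e, ← integral_sub (g := fun x => a + b * x + c * x ^ 2) hf (i3.add i2)]
  simpa using norm_integral_le_of_norm_le_const
    (f := fun x => f x - (a + b * x + c * x ^ 2)) (C := C) h

theorem abs_likelihoodRatio_sub_le (hK : ∀ᵐ x ∂P, |x| ≤ K) (hcent : ∫ x, x ∂P = 0) (z : ℝ)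
    (hs0 : 0 ≤ s) (hs1 : s ≤ 1) :
    |likelihoodRatio P s z - (1 + s ^ 2 * (z ^ 2 - 1) / 2 * ∫ x, x ^ 2 ∂P)| ≤
      2 * s ^ 3 * envelope K z ^ 4 :=
  abs_integral_sub_affine_le hK hcent (integrable_likelihood hK z hs0 hs1)
    (hK.mono fun _ hx => abs_likelihood_sub_quadratic_le z hs0 hs1 hx)

theorem abs_likelihoodRatioDeriv_sub_le (hK : ∀ᵐ x ∂P, |x| ≤ K) (hcent : ∫ x, x ∂P = 0) (z : ℝ)
    (hs0 : 0 ≤ s) (hs1 : s ≤ 1) :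
    |likelihoodRatioDeriv P s z - s * (z ^ 2 - 1) * ∫ x, x ^ 2 ∂P| ≤
      3 * s ^ 2 * envelope K z ^ 4 := by
  have := abs_integral_sub_affine_le (a := 0) hK hcent (integrable_likelihood_deriv hK z hs0 hs1)
    (hK.mono fun x hx => by
      rw [zero_add]; exact abs_likelihood_deriv_sub_linear_le z hs0 hs1 hx)
  simpa [likelihoodRatioDeriv] using this

theorem abs_sq_sub_one_mul_integral_sq_le (hK : ∀ᵐ x ∂P, |x| ≤ K) (z : ℝ) :
    |(z ^ 2 - 1) * ∫ x, x ^ 2 ∂P| ≤ 2 * envelope K z ^ 2 := by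
  have hK0 := nonneg_of_ae_abs_le hK
  have hm : ∫ x, x ^ 2 ∂P ≤ K ^ 2 := by
    have := integral_mono_ae (integrable_sq_of_ae_abs_le hK) (integrable_const (K ^ 2))
      (hK.mono fun x hx => by
        change x ^ 2 ≤ K ^ 2
        rw [← sq_abs x]; gcongr)
    simpa using this
  have hm0 : 0 ≤ ∫ x, x ^ 2 ∂P := integral_nonneg fun x => sq_nonneg x
  set m := ∫ x, x ^ 2 ∂P
  have hE1 := one_le_envelope hK0 z
  have hE : |z| * K + K ^ 2 ≤ envelope K z := by
    have := Real.add_one_le_exp (|z| * K + K ^ 2)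
    unfold envelope; linarith
  have h0 : 0 ≤ |z| * K := by positivity
  have h1 : z ^ 2 * m ≤ (|z| * K) ^ 2 := by
    rw [mul_pow, sq_abs]; gcongr
  have h2 : (|z| * K) ^ 2 ≤ envelope K z ^ 2 := by
    gcongr; nlinarith [sq_nonneg K]
  have h3 : m ≤ envelope K z ^ 2 := by nlinarith
  have h4 : 0 ≤ z ^ 2 * m := by positivity
  rw [abs_le]
  constructor <;> nlinarith

theorem abs_likelihoodRatio_sub_one_le (hK : ∀ᵐ x ∂P, |x| ≤ K) (hcent : ∫ x, x ∂P = 0) (z : ℝ)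
    (hs0 : 0 ≤ s) (hs1 : s ≤ 1) :
    |likelihoodRatio P s z - 1| ≤ 3 * s ^ 2 * envelope K z ^ 4 := by
  have hE1 := one_le_envelope (nonneg_of_ae_abs_le hK) z
  have h1 := abs_likelihoodRatio_sub_le hK hcent z hs0 hs1
  have h2 := abs_sq_sub_one_mul_integral_sq_le hK z
  set m := ∫ x, x ^ 2 ∂P
  have h3 : |s ^ 2 * (z ^ 2 - 1) / 2 * m| ≤ s ^ 2 * envelope K z ^ 4 := by
    calc _ = s ^ 2 / 2 * |(z ^ 2 - 1) * m| := by
          rw [show s ^ 2 * (z ^ 2 - 1) / 2 * m = s ^ 2 / 2 * ((z ^ 2 - 1) * m) by ring, abs_mul,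
            abs_of_nonneg (show 0 ≤ s ^ 2 / 2 by positivity)]
      _ ≤ s ^ 2 / 2 * (2 * envelope K z ^ 4) := by
          gcongr; exact h2.trans (by gcongr; norm_num)
      _ = _ := by ring
  have h4 : 2 * s ^ 3 * envelope K z ^ 4 ≤ 2 * s ^ 2 * envelope K z ^ 4 := by
    gcongr 2 * ?_ * _
    exact pow_le_pow_of_le_one hs0 hs1 (by norm_num)
  calc _ = |(likelihoodRatio P s z - (1 + s ^ 2 * (z ^ 2 - 1) / 2 * m)) +
        s ^ 2 * (z ^ 2 - 1) / 2 * m| := by ring_nf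
    _ ≤ _ := abs_add_le _ _
    _ ≤ _ := by linarith

theorem abs_likelihoodRatioDeriv_le (hK : ∀ᵐ x ∂P, |x| ≤ K) (hcent : ∫ x, x ∂P = 0) (z : ℝ)
    (hs0 : 0 ≤ s) (hs1 : s ≤ 1) :
    |likelihoodRatioDeriv P s z| ≤ 5 * s * envelope K z ^ 4 := by
  have hE1 := one_le_envelope (nonneg_of_ae_abs_le hK) z
  have h1 := abs_likelihoodRatioDeriv_sub_le hK hcent z hs0 hs1
  have h2 := abs_sq_sub_one_mul_integral_sq_le hK z
  set m := ∫ x, x ^ 2 ∂P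
  have h3 : |s * (z ^ 2 - 1) * m| ≤ 2 * s * envelope K z ^ 4 := by
    rw [mul_assoc, abs_mul, abs_of_nonneg hs0]
    calc _ ≤ s * (2 * envelope K z ^ 4) := by
          gcongr; exact h2.trans (by gcongr; norm_num)
      _ = _ := by ring
  have h4 : 3 * s ^ 2 * envelope K z ^ 4 ≤ 3 * s * envelope K z ^ 4 := by
    gcongr 3 * ?_ * _
    nlinarith
  calc _ = |(likelihoodRatioDeriv P s z - s * (z ^ 2 - 1) * m) + s * (z ^ 2 - 1) * m| := by
        ring_nf
    _ ≤ _ := abs_add_le _ _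
    _ ≤ _ := by linarith

theorem abs_log_likelihoodRatio_le (hK : ∀ᵐ x ∂P, |x| ≤ K) (z : ℝ) (hs0 : 0 ≤ s) (hs1 : s ≤ 1) :
    |Real.log (likelihoodRatio P s z)| ≤ envelope K z := by
  have h := likelihoodRatio_mem_Icc hK z hs0 hs1
  have hpos := likelihoodRatio_pos hK z hs0 hs1
  have hE := Real.add_one_le_exp (|z| * K + K ^ 2)
  have h1 := Real.log_le_log hpos h.2
  have h2 := Real.log_le_log (inv_pos.2 (Real.exp_pos _)) h.1
  simp only [envelope, Real.log_inv, Real.log_exp] at h1 h2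
  rw [abs_le, envelope]
  constructor <;> linarith

theorem abs_log_likelihoodRatio_sub_le (hK : ∀ᵐ x ∂P, |x| ≤ K) (hcent : ∫ x, x ∂P = 0) (z : ℝ)
    (hs0 : 0 ≤ s) (hs1 : s ≤ 1) :
    |Real.log (likelihoodRatio P s z) - s ^ 2 * (z ^ 2 - 1) / 2 * ∫ x, x ^ 2 ∂P| ≤
      11 * s ^ 3 * envelope K z ^ 9 := by
  have hE1 := one_le_envelope (nonneg_of_ae_abs_le hK) z
  have hpos := likelihoodRatio_pos hK z hs0 hs1
  have h1 := abs_likelihoodRatio_sub_le hK hcent z hs0 hs1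
  have h2 := abs_likelihoodRatio_sub_one_le hK hcent z hs0 hs1
  have hinv : (likelihoodRatio P s z)⁻¹ ≤ envelope K z :=
    inv_le_of_inv_le₀ (Real.exp_pos _) (likelihoodRatio_mem_Icc hK z hs0 hs1).1
  have h3 := abs_log_sub_le hpos
  set L := likelihoodRatio P s z
  have h4 : (L - 1) ^ 2 / L ≤ 9 * s ^ 3 * envelope K z ^ 9 := by
    rw [← sq_abs, div_eq_mul_inv]
    calc _ ≤ (3 * s ^ 2 * envelope K z ^ 4) ^ 2 * envelope K z := by gcongr
      _ = 9 * s ^ 4 * envelope K z ^ 9 := by ring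
      _ ≤ _ := by
        gcongr 9 * ?_ * _
        exact pow_le_pow_of_le_one hs0 hs1 (by norm_num)
  have h5 : 2 * s ^ 3 * envelope K z ^ 4 ≤ 2 * s ^ 3 * envelope K z ^ 9 := by
    gcongr; norm_num
  set m := ∫ x, x ^ 2 ∂P
  calc _ = |(Real.log L - (L - 1)) + (L - (1 + s ^ 2 * (z ^ 2 - 1) / 2 * m))| := by ring_nf
    _ ≤ _ := abs_add_le _ _
    _ ≤ _ := by linarith

theorem abs_log_mul_likelihoodRatioDeriv_sub_le (hK : ∀ᵐ x ∂P, |x| ≤ K) (hcent : ∫ x, x ∂P = 0)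
    (z : ℝ) (hs0 : 0 ≤ s) (hs1 : s ≤ 1) :
    |Real.log (likelihoodRatio P s z) * likelihoodRatioDeriv P s z -
        s ^ 3 * (∫ x, x ^ 2 ∂P) ^ 2 / 2 * (z ^ 2 - 1) ^ 2| ≤
      58 * s ^ 4 * envelope K z ^ 13 := by
  have hE1 := one_le_envelope (nonneg_of_ae_abs_le hK) z
  have h1 := abs_log_likelihoodRatio_sub_le hK hcent z hs0 hs1
  have h2 := abs_likelihoodRatioDeriv_sub_le hK hcent z hs0 hs1
  have h3 := abs_likelihoodRatioDeriv_le hK hcent z hs0 hs1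
  have h4 := abs_sq_sub_one_mul_integral_sq_le hK z
  set m := ∫ x, x ^ 2 ∂P
  set D := likelihoodRatioDeriv P s z
  set l := Real.log (likelihoodRatio P s z)
  have h5 : |s ^ 2 * (z ^ 2 - 1) / 2 * m| ≤ s ^ 2 * envelope K z ^ 2 := by
    calc _ = s ^ 2 / 2 * |(z ^ 2 - 1) * m| := by
          rw [show s ^ 2 * (z ^ 2 - 1) / 2 * m = s ^ 2 / 2 * ((z ^ 2 - 1) * m) by ring, abs_mul,
            abs_of_nonneg (show 0 ≤ s ^ 2 / 2 by positivity)]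
      _ ≤ s ^ 2 / 2 * (2 * envelope K z ^ 2) := by gcongr
      _ = _ := by ring
  have h6 : envelope K z ^ 6 ≤ envelope K z ^ 13 := by gcongr; norm_num
  calc _ = |(l - s ^ 2 * (z ^ 2 - 1) / 2 * m) * D +
        s ^ 2 * (z ^ 2 - 1) / 2 * m * (D - s * (z ^ 2 - 1) * m)| := by ring_nf
    _ ≤ _ := abs_add_le _ _
    _ = |l - s ^ 2 * (z ^ 2 - 1) / 2 * m| * |D| +
        |s ^ 2 * (z ^ 2 - 1) / 2 * m| * |D - s * (z ^ 2 - 1) * m| := by rw [abs_mul, abs_mul]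
    _ ≤ 11 * s ^ 3 * envelope K z ^ 9 * (5 * s * envelope K z ^ 4) +
        s ^ 2 * envelope K z ^ 2 * (3 * s ^ 2 * envelope K z ^ 4) := by gcongr
    _ = 55 * s ^ 4 * envelope K z ^ 13 + 3 * s ^ 4 * envelope K z ^ 6 := by ring
    _ ≤ 55 * s ^ 4 * envelope K z ^ 13 + 3 * s ^ 4 * envelope K z ^ 13 := by gcongr
    _ = _ := by ring

theorem integrable_entropy (hK : ∀ᵐ x ∂P, |x| ≤ K) (hs0 : 0 ≤ s) (hs1 : s ≤ 1) :
    Integrable (fun z => likelihoodRatio P s z * Real.log (likelihoodRatio P s z))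
      (gaussianReal 0 1) := by
  have hL := measurable_likelihoodRatio P s
  refine (integrable_envelope_pow K 2).mono' (by fun_prop)
    (Filter.Eventually.of_forall fun z => ?_)
  rw [Real.norm_eq_abs, abs_mul, abs_of_pos (likelihoodRatio_pos hK z hs0 hs1), sq]
  gcongr
  · exact (one_pos.trans_le (one_le_envelope (nonneg_of_ae_abs_le hK) z)).le
  · exact (likelihoodRatio_mem_Icc hK z hs0 hs1).2
  · exact abs_log_likelihoodRatio_le hK z hs0 hs1

theorem integrable_likelihoodRatio (hK : ∀ᵐ x ∂P, |x| ≤ K) (hs0 : 0 ≤ s) (hs1 : s ≤ 1) :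
    Integrable (likelihoodRatio P s) (gaussianReal 0 1) := by
  refine (integrable_envelope_pow K 1).mono' (measurable_likelihoodRatio P s).aestronglyMeasurable
    (Filter.Eventually.of_forall fun z => ?_)
  rw [Real.norm_eq_abs, abs_of_pos (likelihoodRatio_pos hK z hs0 hs1), pow_one]
  exact (likelihoodRatio_mem_Icc hK z hs0 hs1).2

/-- Change of measure from the planted observation `z + s x` to pure noise. -/
theorem integral_planted_eq (hK : ∀ᵐ x ∂P, |x| ≤ K) (hs0 : 0 ≤ s) (hs1 : s ≤ 1) {f : ℝ → ℝ}
    (hf : Measurable f) (hfE : ∀ z, |f z| ≤ envelope K z) :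
    ∫ x, ∫ z, f (z + s * x) ∂(gaussianReal 0 1) ∂P =
      ∫ z, likelihoodRatio P s z * f z ∂(gaussianReal 0 1) := by
  have h_int : Integrable (fun p : ℝ × ℝ =>
      f p.2 * Real.exp (s * p.2 * p.1 - s ^ 2 * p.1 ^ 2 / 2)) (P.prod (gaussianReal 0 1)) := by
    refine ((integrable_envelope_pow K 2).comp_snd P).mono' (by fun_prop) ?_
    filter_upwards [Measure.quasiMeasurePreserving_fst.ae hK] with p hp
    have hK0 : 0 ≤ K := (abs_nonneg _).trans hp
    have h := (abs_exponent_le p.2 hs0 hs1 hp).trans (mul_le_of_le_one_left (by positivity) hs1)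
    rw [Real.norm_eq_abs, abs_mul, Real.abs_exp, sq (envelope K p.2)]
    gcongr
    · exact (Real.exp_pos _).le
    · exact hfE _
    · exact Real.exp_le_exp.2 ((le_abs_self _).trans h)
  simp only [integral_gaussianReal_add_const]
  calc _ = ∫ x, ∫ z, f z * Real.exp (s * z * x - s ^ 2 * x ^ 2 / 2) ∂(gaussianReal 0 1) ∂P := by
        congr! 6; ring
    _ = ∫ z, ∫ x, f z * Real.exp (s * z * x - s ^ 2 * x ^ 2 / 2) ∂P ∂(gaussianReal 0 1) :=
        integral_integral_swap h_int
    _ = _ := by simp only [integral_const_mul, likelihoodRatio, mul_comm]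

theorem integral_likelihoodRatio (hK : ∀ᵐ x ∂P, |x| ≤ K) (hs0 : 0 ≤ s) (hs1 : s ≤ 1) :
    ∫ z, likelihoodRatio P s z ∂(gaussianReal 0 1) = 1 := by
  have := integral_planted_eq (f := fun _ => 1) hK hs0 hs1 measurable_const (fun z => by
    simpa using one_le_envelope (nonneg_of_ae_abs_le hK) z)
  simpa using this.symm

variable (P s) in
/-- The relative entropy of the channel output with respect to pure noise, with the nonnegative
integrand `L log L - L + 1`. -/
noncomputable def relEntropy : ℝ :=
  ∫ z, (likelihoodRatio P s z * Real.log (likelihoodRatio P s z) - likelihoodRatio P s z + 1)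
    ∂(gaussianReal 0 1)

theorem relEntropy_eq (hK : ∀ᵐ x ∂P, |x| ≤ K) (hs0 : 0 ≤ s) (hs1 : s ≤ 1) :
    relEntropy P s =
      ∫ x, ∫ z, Real.log (likelihoodRatio P s (z + s * x)) ∂(gaussianReal 0 1) ∂P := by
  rw [integral_planted_eq (f := fun y => Real.log (likelihoodRatio P s y)) hK hs0 hs1
      (measurable_likelihoodRatio P s).log fun z => abs_log_likelihoodRatio_le hK z hs0 hs1,
    relEntropy, integral_add (f := fun z => likelihoodRatio P s z *
        Real.log (likelihoodRatio P s z) - likelihoodRatio P s z)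
      ((integrable_entropy hK hs0 hs1).sub (integrable_likelihoodRatio hK hs0 hs1))
      (integrable_const _),
    integral_sub (integrable_entropy hK hs0 hs1) (integrable_likelihoodRatio hK hs0 hs1),
    integral_likelihoodRatio hK hs0 hs1]
  simp

theorem hasDerivAt_relEntropy (hK : ∀ᵐ x ∂P, |x| ≤ K) (hcent : ∫ x, x ∂P = 0)
    (hs : s ∈ Set.Ioo (0 : ℝ) 1) :
    HasDerivAt (relEntropy P)
      (∫ z, Real.log (likelihoodRatio P s z) * likelihoodRatioDeriv P s z ∂(gaussianReal 0 1))
      s := by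
  have hL := fun t => measurable_likelihoodRatio P t
  have hL' := measurable_likelihoodRatioDeriv P s
  refine (hasDerivAt_integral_of_dominated_loc_of_deriv_le
    (F' := fun t z => Real.log (likelihoodRatio P t z) * likelihoodRatioDeriv P t z)
    (bound := fun z => 5 * envelope K z ^ 5)
    (Ioo_mem_nhds hs.1 hs.2) (Filter.Eventually.of_forall fun t => by fun_prop)
    (((integrable_entropy hK hs.1.le hs.2.le).sub
      (integrable_likelihoodRatio hK hs.1.le hs.2.le)).add (integrable_const _))
    (by fun_prop) (Filter.Eventually.of_forall fun z t ht => ?_)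
    ((integrable_envelope_pow K 5).const_mul 5)
    (Filter.Eventually.of_forall fun z t ht => ?_)).2
  · have hE1 := one_le_envelope (nonneg_of_ae_abs_le hK) z
    rw [Real.norm_eq_abs, abs_mul]
    calc _ ≤ envelope K z * (5 * t * envelope K z ^ 4) := by
          gcongr
          · exact abs_log_likelihoodRatio_le hK z ht.1.le ht.2.le
          · exact abs_likelihoodRatioDeriv_le hK hcent z ht.1.le ht.2.le
      _ ≤ envelope K z * (5 * 1 * envelope K z ^ 4) := by
          gcongr; exact ht.2.le
      _ = _ := by ring
  · have h := hasDerivAt_likelihoodRatio hK z ht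
    have hpos := likelihoodRatio_pos hK z ht.1.le ht.2.le
    refine (((h.mul (h.log hpos.ne')).sub h).add_const 1).congr_deriv ?_
    field_simp
    ring

theorem relEntropy_nonneg (hK : ∀ᵐ x ∂P, |x| ≤ K) (hs0 : 0 ≤ s) (hs1 : s ≤ 1) :
    0 ≤ relEntropy P s := by
  refine integral_nonneg fun z => ?_
  have hpos := likelihoodRatio_pos hK z hs0 hs1
  have h := mul_le_mul_of_nonneg_left (Real.one_sub_inv_le_log_of_pos hpos) hpos.le
  rw [mul_sub, mul_inv_cancel₀ hpos.ne'] at h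
  change 0 ≤ _
  linarith

theorem relEntropy_le (hK : ∀ᵐ x ∂P, |x| ≤ K) (hcent : ∫ x, x ∂P = 0) (hs0 : 0 ≤ s)
    (hs1 : s ≤ 1) :
    relEntropy P s ≤ 9 * (∫ z, envelope K z ^ 8 ∂(gaussianReal 0 1)) * s ^ 4 := by
  have hi := ((integrable_entropy hK hs0 hs1).sub (integrable_likelihoodRatio hK hs0 hs1)).add
    (integrable_const 1)
  calc relEntropy P s ≤ ∫ z, 9 * s ^ 4 * envelope K z ^ 8 ∂(gaussianReal 0 1) := by
        refine integral_mono hi ((integrable_envelope_pow K 8).const_mul _) fun z => ?_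
        have hpos := likelihoodRatio_pos hK z hs0 hs1
        have h := mul_le_mul_of_nonneg_left (Real.log_le_sub_one_of_pos hpos) hpos.le
        have h1 := pow_le_pow_left₀ (abs_nonneg _)
          (abs_likelihoodRatio_sub_one_le hK hcent z hs0 hs1) 2
        rw [sq_abs] at h1
        change likelihoodRatio P s z * Real.log (likelihoodRatio P s z) - likelihoodRatio P s z + 1
          ≤ _
        nlinarith
    _ = _ := by rw [integral_const_mul]; ring

theorem abs_relEntropy_deriv_sub_le (hK : ∀ᵐ x ∂P, |x| ≤ K) (hcent : ∫ x, x ∂P = 0)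
    (hs0 : 0 ≤ s) (hs1 : s ≤ 1) :
    |∫ z, Real.log (likelihoodRatio P s z) * likelihoodRatioDeriv P s z ∂(gaussianReal 0 1) -
        (∫ x, x ^ 2 ∂P) ^ 2 * s ^ 3| ≤
      58 * (∫ z, envelope K z ^ 13 ∂(gaussianReal 0 1)) * s ^ 4 := by
  have hL := measurable_likelihoodRatio P s
  have hL' := measurable_likelihoodRatioDeriv P s
  have hE := fun z => one_le_envelope (nonneg_of_ae_abs_le hK) z
  have hi : Integrable (fun z => Real.log (likelihoodRatio P s z) * likelihoodRatioDeriv P s z)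
      (gaussianReal 0 1) := by
    refine ((integrable_envelope_pow K 5).const_mul (5 * s)).mono' (by fun_prop)
      (Filter.Eventually.of_forall fun z => ?_)
    have hE1 := hE z
    rw [Real.norm_eq_abs, abs_mul]
    calc _ ≤ envelope K z * (5 * s * envelope K z ^ 4) := by
          gcongr
          · exact abs_log_likelihoodRatio_le hK z hs0 hs1
          · exact abs_likelihoodRatioDeriv_le hK hcent z hs0 hs1
      _ = _ := by ring
  have hq : Integrable (fun z : ℝ => (z ^ 2 - 1) ^ 2) (gaussianReal 0 1) :=
    .of_integral_ne_zero (by rw [integral_sq_sub_one_sq_gaussianReal]; norm_num)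
  set m := ∫ x, x ^ 2 ∂P
  calc _ = |∫ z, (Real.log (likelihoodRatio P s z) * likelihoodRatioDeriv P s z -
        s ^ 3 * m ^ 2 / 2 * (z ^ 2 - 1) ^ 2) ∂(gaussianReal 0 1)| := by
        rw [integral_sub hi (hq.const_mul _), integral_const_mul,
          integral_sq_sub_one_sq_gaussianReal]
        congr 2; ring
    _ ≤ ∫ z, 58 * s ^ 4 * envelope K z ^ 13 ∂(gaussianReal 0 1) := by
        rw [← Real.norm_eq_abs]
        exact norm_integral_le_of_norm_le ((integrable_envelope_pow K 13).const_mul _)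
          (Filter.Eventually.of_forall fun z =>
            abs_log_mul_likelihoodRatioDeriv_sub_le hK hcent z hs0 hs1)
    _ = _ := by rw [integral_const_mul]; ring

end BoundedSupport

open Filter Topology Asymptotics in
theorem hasDerivWithinAt_zero_of_abs_sub_le {g : ℝ → ℝ} {c C : ℝ}
    (h : ∀ᶠ q in 𝓝[≥] 0, |g q - g 0 - c * q| ≤ C * (q * √q)) :
    HasDerivWithinAt g c (Set.Ici 0) 0 := by
  rw [hasDerivWithinAt_iff_isLittleO]
  have hsqrt : (fun q : ℝ => √q) =o[𝓝[≥] 0] fun _ => (1 : ℝ) := by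
    rw [isLittleO_one_iff]
    have := (Real.continuous_sqrt.tendsto 0).mono_left (nhdsWithin_le_nhds (s := Set.Ici (0 : ℝ)))
    simpa using this
  have hq : (fun q : ℝ => q * √q) =o[𝓝[≥] 0] fun q => q := by
    simpa using (isBigO_refl (fun q : ℝ => q) (𝓝[≥] 0)).mul_isLittleO hsqrt
  refine IsBigO.trans_isLittleO (IsBigO.of_bound C ?_) (by simpa using hq)
  filter_upwards [h, self_mem_nhdsWithin] with q hq hq0
  have hq0' : 0 ≤ q := hq0
  rw [Real.norm_eq_abs, Real.norm_of_nonneg (by positivity)]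
  simpa [mul_comm] using hq

open Filter Topology in
/-- Second-order behaviour at the left endpoint, read off from an expansion of the derivative. -/
theorem derivWithin_Ici_of_deriv_expansion {f f' : ℝ → ℝ} {a C δ : ℝ} (hδ : 0 < δ) (h0 : f 0 = 0)
    (hf : ∀ q ∈ Set.Ioo 0 δ, |f q| ≤ C * (q * √q))
    (hd : ∀ q ∈ Set.Ioo 0 δ, HasDerivAt f (f' q) q)
    (hf' : ∀ q ∈ Set.Ioo 0 δ, |f' q - a * q| ≤ C * (q * √q)) :
    derivWithin f (Set.Ici 0) 0 = 0 ∧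
      derivWithin (derivWithin f (Set.Ici 0)) (Set.Ici 0) 0 = a ∧
      (0 < a → ¬ IsLocalMaxOn f (Set.Ici 0) 0) := by
  have hu : UniqueDiffWithinAt ℝ (Set.Ici (0 : ℝ)) 0 := uniqueDiffOn_Ici 0 0 Set.self_mem_Ici
  have hmem : ∀ᶠ q : ℝ in 𝓝[≥] 0, q ∈ Set.Ico 0 δ := Ico_mem_nhdsGE hδ
  have hd0 : HasDerivWithinAt f 0 (Set.Ici 0) 0 := by
    refine hasDerivWithinAt_zero_of_abs_sub_le (C := C) (hmem.mono fun q hq => ?_)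
    rcases hq.1.eq_or_lt with rfl | hq0
    · simp
    · simpa [h0] using hf q ⟨hq0, hq.2⟩
  have hD0 := hd0.derivWithin hu
  refine ⟨hD0, ?_, fun ha hmax => ?_⟩
  · refine (hasDerivWithinAt_zero_of_abs_sub_le (C := C) (hmem.mono fun q hq => ?_)).derivWithin hu
    rcases hq.1.eq_or_lt with rfl | hq0
    · simp
    · rw [hD0, derivWithin_of_mem_nhds (Ici_mem_nhds hq0), (hd q ⟨hq0, hq.2⟩).deriv]
      simpa using hf' q ⟨hq0, hq.2⟩
  · have hsmall : ∀ᶠ q : ℝ in 𝓝[≥] 0, C * √q < a := by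
      have : Tendsto (fun q : ℝ => C * √q) (𝓝 0) (𝓝 (C * √0)) :=
        (continuous_const.mul Real.continuous_sqrt).tendsto 0
      rw [Real.sqrt_zero, mul_zero] at this
      exact nhdsWithin_le_nhds (this.eventually_lt_const ha)
    obtain ⟨ε, hε, hεs⟩ := (mem_nhdsGE_iff_exists_Icc_subset).1
      ((hmem.and hsmall).and hmax)
    have hε0 : 0 < ε := hε
    have hIoo : ∀ q ∈ Set.Ioo 0 ε, q ∈ Set.Ioo 0 δ := fun q hq =>
      ⟨hq.1, (hεs ⟨hq.1.le, hq.2.le⟩).1.1.2⟩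
    have hcont : ContinuousOn f (Set.Icc 0 ε) := by
      intro q hq
      rcases hq.1.eq_or_lt with rfl | hq0
      · exact hd0.continuousWithinAt.mono Set.Icc_subset_Ici_self
      · exact (hd q ⟨hq0, (hεs hq).1.1.2⟩).continuousAt.continuousWithinAt
    have hmono : StrictMonoOn f (Set.Icc 0 ε) := by
      refine strictMonoOn_of_deriv_pos (convex_Icc 0 ε) hcont fun q hq => ?_
      rw [interior_Icc] at hq
      rw [(hd q (hIoo q hq)).deriv]
      have h1 := (abs_le.1 (hf' q (hIoo q hq))).1
      have h2 := mul_lt_mul_of_pos_left (hεs ⟨hq.1.le, hq.2.le⟩).1.2 hq.1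
      linarith
    have h1 := hmono ⟨le_rfl, hε0.le⟩ ⟨hε0.le, le_rfl⟩ hε0
    have h2 : f ε ≤ f 0 := (hεs ⟨hε0.le, le_rfl⟩).2
    exact h1.not_ge h2

theorem stmt1 (P : Measure ℝ) [IsProbabilityMeasure P]
    (K : ℝ) (hK : ∀ᵐ x ∂P, |x| ≤ K)
    (hcent : (∫ x, x ∂P) = 0) (hm2 : 0 < ∫ x, x ^ 2 ∂P)
    (ψ : ℝ → ℝ)
    (hψ : ∀ r : ℝ, ψ r =
      ∫ xs, ∫ z, Real.log (∫ x,
          Real.exp (Real.sqrt r * z * x + r * x * xs - r / 2 * x ^ 2) ∂P)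
        ∂(gaussianReal 0 1) ∂P)
    (F : ℝ → ℝ → ℝ)
    (hF : ∀ lam q : ℝ, F lam q = ψ (lam * q) - lam * q ^ 2 / 4)
    (lam : ℝ) (hlam : lam > ((∫ x, x ^ 2 ∂P) ^ 2)⁻¹) :
    ¬ IsLocalMaxOn (F lam) (Set.Ici 0) 0 ∧
    derivWithin (F lam) (Set.Ici 0) 0 = 0 ∧
    derivWithin (derivWithin (F lam) (Set.Ici 0)) (Set.Ici 0) 0
      = lam / 2 * (lam * (∫ x, x ^ 2 ∂P) ^ 2 - 1) ∧
    0 < lam / 2 * (lam * (∫ x, x ^ 2 ∂P) ^ 2 - 1) := by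
  set m := ∫ x, x ^ 2 ∂P with hm
  have hlam0 : 0 < lam := lt_trans (by positivity) hlam
  have ha : 0 < lam / 2 * (lam * m ^ 2 - 1) := by
    have : 1 < lam * m ^ 2 := by
      rw [gt_iff_lt, inv_lt_iff_one_lt_mul₀ (by positivity)] at hlam
      linarith
    exact mul_pos (by positivity) (by linarith)
  have hψs : ∀ r ∈ Set.Icc (0 : ℝ) 1, ψ r = relEntropy P (√r) := by
    intro r hr
    rw [relEntropy_eq hK (Real.sqrt_nonneg r) (Real.sqrt_le_one.2 hr.2), hψ]
    have hsq := Real.sq_sqrt hr.1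
    simp only [likelihoodRatio]
    congr! 8 with xs z x
    rw [hsq]
    linear_combination (-x * xs) * hsq
  set C₁ := 9 * ∫ z, envelope K z ^ 8 ∂(gaussianReal 0 1)
  set C₂ := 58 * ∫ z, envelope K z ^ 13 ∂(gaussianReal 0 1)
  have hC₁ : 0 ≤ C₁ :=
    mul_nonneg (by norm_num) (integral_nonneg fun z => pow_nonneg (Real.exp_pos _).le _)
  have hC₂ : 0 ≤ C₂ :=
    mul_nonneg (by norm_num) (integral_nonneg fun z => pow_nonneg (Real.exp_pos _).le _)
  have hlq : ∀ q ∈ Set.Ioo 0 (min 1 lam⁻¹), lam * q ∈ Set.Ioo (0 : ℝ) 1 := fun q hq =>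
    ⟨mul_pos hlam0 hq.1, by
      have := mul_lt_mul_of_pos_left (hq.2.trans_le (min_le_right _ _)) hlam0
      rwa [mul_inv_cancel₀ hlam0.ne'] at this⟩
  have hF0 : F lam 0 = 0 := by
    have h1 := relEntropy_nonneg (s := 0) hK le_rfl zero_le_one
    have h2 := relEntropy_le (s := 0) hK hcent le_rfl zero_le_one
    have h3 : ψ 0 = 0 := by
      rw [hψs 0 (by simp), Real.sqrt_zero]
      exact le_antisymm (by simpa using h2) h1
    simp [hF, h3]
  suffices h : derivWithin (F lam) (Set.Ici 0) 0 = 0 ∧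
      derivWithin (derivWithin (F lam) (Set.Ici 0)) (Set.Ici 0) 0 =
        lam / 2 * (lam * m ^ 2 - 1) ∧
      (0 < lam / 2 * (lam * m ^ 2 - 1) → ¬ IsLocalMaxOn (F lam) (Set.Ici 0) 0) from
    ⟨h.2.2 ha, h.1, h.2.1, ha⟩
  refine derivWithin_Ici_of_deriv_expansion (f := F lam)
    (f' := fun q => (∫ z, Real.log (likelihoodRatio P √(lam * q) z) *
      likelihoodRatioDeriv P √(lam * q) z ∂(gaussianReal 0 1)) * (lam / (2 * √(lam * q))) -
        lam * q / 2)
    (a := lam / 2 * (lam * m ^ 2 - 1))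
    (C := C₁ * lam ^ 2 + lam / 4 + C₂ * lam ^ 2 * √lam / 2)
    (δ := min 1 lam⁻¹) (lt_min one_pos (inv_pos.2 hlam0)) hF0 ?_ ?_ ?_
  · intro q hq
    have hr := hlq q hq
    have hq0 := hq.1
    have hs0 := Real.sqrt_nonneg (lam * q)
    have hs1 := Real.sqrt_le_one.2 hr.2.le
    have hψ0 := relEntropy_nonneg hK hs0 hs1
    have hψ1 := relEntropy_le hK hcent hs0 hs1
    rw [← hψs _ ⟨hr.1.le, hr.2.le⟩] at hψ0 hψ1
    rw [show √(lam * q) ^ 4 = (√(lam * q) ^ 2) ^ 2 by ring, Real.sq_sqrt hr.1.le] at hψ1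
    have hqq : q ^ 2 ≤ q * √q := by
      rw [sq]
      gcongr
      exact Real.le_sqrt_of_sq_le (by nlinarith [hq.2.trans_le (min_le_left _ _)])
    rw [hF]
    calc |ψ (lam * q) - lam * q ^ 2 / 4| ≤ (C₁ * lam ^ 2 + lam / 4) * q ^ 2 := by
          have : 0 ≤ lam * q ^ 2 := by positivity
          have : 0 ≤ C₁ * (lam * q) ^ 2 := by positivity
          rw [abs_le]
          constructor <;> nlinarith
      _ ≤ _ := mul_le_mul (le_add_of_nonneg_right (by positivity)) hqq (by positivity)
          (by positivity)
  · intro q hq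
    have hr := hlq q hq
    have hs0 : 0 < √(lam * q) := Real.sqrt_pos.2 hr.1
    have hs1 : √(lam * q) < 1 := by
      rw [Real.sqrt_lt' one_pos]; simpa using hr.2
    have hlin : HasDerivAt (fun q : ℝ => lam * q) lam q := by
      simpa using (hasDerivAt_id q).const_mul lam
    have hd := ((hasDerivAt_relEntropy hK hcent ⟨hs0, hs1⟩).comp q
      (hlin.sqrt hr.1.ne')).sub
      (((hasDerivAt_pow 2 q).const_mul lam).div_const 4)
    refine (hd.congr_of_eventuallyEq ?_).congr_deriv ?_
    · filter_upwards [Ioo_mem_nhds hq.1 hq.2] with t ht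
      rw [hF, hψs _ ⟨(hlq t ht).1.le, (hlq t ht).2.le⟩]
      rfl
    · simp
      ring
  · intro q hq
    have hr := hlq q hq
    have hq0 := hq.1
    have hs0 : 0 < √(lam * q) := Real.sqrt_pos.2 hr.1
    have hs1 := Real.sqrt_le_one.2 hr.2.le
    have hD := abs_relEntropy_deriv_sub_le hK hcent hs0.le hs1
    have hsq := Real.sq_sqrt hr.1.le
    have hsmul : √(lam * q) = √lam * √q := Real.sqrt_mul hlam0.le q
    rw [← hm] at hD
    set s := √(lam * q)
    set D := ∫ z, Real.log (likelihoodRatio P s z) * likelihoodRatioDeriv P s z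
      ∂(gaussianReal 0 1)
    calc |D * (lam / (2 * s)) - lam * q / 2 - lam / 2 * (lam * m ^ 2 - 1) * q|
        = |lam / (2 * s) * (D - m ^ 2 * s ^ 3)| := by
          congr 1
          field_simp
          linear_combination (m ^ 2 * s) * hsq
      _ = lam / (2 * s) * |D - m ^ 2 * s ^ 3| := by
          rw [abs_mul, abs_of_pos (by positivity)]
      _ ≤ lam / (2 * s) * (C₂ * s ^ 4) := by gcongr
      _ = C₂ * lam / 2 * (s ^ 2 * s) := by field_simp
      _ = C₂ * lam ^ 2 * √lam / 2 * (q * √q) := by rw [hsq, hsmul]; ring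
      _ ≤ _ := by
          gcongr
          exact le_add_of_nonneg_left (by positivity)
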